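/- Let S, N_P ∈ ℕ with S, N_P ≥ 1, let P be a probability measure on Θ, and let λ > 0, C > 0, δ ∈ (0,1). Let Q* be the Markov kernel from W^S to Θ with dQ*(S)/dP (θ) = exp(−λ L̂(θ, S)) / Z_λ(P, S), and let Ẑ_λ(θ₁, …, θ_{N_P}, S) = (1/N_P) Σ_{n=1}^{N_P} exp(−λ L̂(θ_n, S)). Then, with probability at least 1 − 2δ under the joint law obtained by independently sampling S ∼ D^{⊗S}, θ ∼ Q*(S), and (θ₁, …, θ_{N_P}) ∼ P^{⊗N_P}, the true cost satisfies 𝓛(θ) ≤ −(1/λ) ln Ẑ_λ(θ₁, …, θ_{N_P}, S) + (1/λ) ln(1/δ) + λ C² / (8 S) + (1/λ) ln(1 + (exp(λC) − 1)/N_P) · √( (N_P/2) ln(1/δ) ). -/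

import Mathlib

open MeasureTheory ProbabilityTheory

lemma aux_hoeffding {Ω : Type*} [MeasurableSpace Ω] (μ : Measure Ω) [IsProbabilityMeasure μ]
    (g : Ω → ℝ) (hg : Measurable g) (M c : ℝ) (hM : ∀ x, |g x| ≤ M) 
    (hd : ∀ x y, g x - g y ≤ c) (s : ℝ) :
    ∫ x, Real.exp (s * g x) ∂μ ≤ Real.exp (s * ∫ x, g x ∂μ + s ^ 2 * c ^ 2 / 8) := by
  have : Nonempty Ω := nonempty_of_isProbabilityMeasure μ
  have hbdd : BddBelow (Set.range g) := ⟨-M, by rintro _ ⟨x, rfl⟩; exact (abs_le.1 (hM x)).1⟩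
  have h := (hasSubgaussianMGF_of_mem_Icc (μ := μ) (X := g) (a := ⨅ x, g x) (b := (⨅ x, g x) + c)
    hg.aemeasurable (ae_of_all _ fun x => ⟨ciInf_le hbdd x, by
      have : g x - c ≤ ⨅ y, g y := le_ciInf fun y => by linarith [hd x y]
      linarith⟩)).mgf_le s
  have e : mgf (fun ω ↦ g ω - ∫ x, g x ∂μ) μ s
      = Real.exp (- (s * ∫ x, g x ∂μ)) * ∫ x, Real.exp (s * g x) ∂μ := by
    rw [mgf, ← integral_const_mul]
    congr 1; ext x; rw [← Real.exp_add]; ring_nf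
  rw [e] at h
  calc ∫ x, Real.exp (s * g x) ∂μ = Real.exp (s * ∫ x, g x ∂μ) *
        (Real.exp (- (s * ∫ x, g x ∂μ)) * ∫ x, Real.exp (s * g x) ∂μ) := by
        rw [← mul_assoc, ← Real.exp_add]; simp
    _ ≤ Real.exp (s * ∫ x, g x ∂μ) * _ := mul_le_mul_of_nonneg_left h (Real.exp_pos _).le
    _ = _ := by
      rw [← Real.exp_add]; congr 2
      simp only [add_sub_cancel_left, NNReal.coe_pow, NNReal.coe_div, coe_nnnorm, Real.norm_eq_abs, NNReal.coe_ofNat, div_pow, sq_abs]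
      ring

lemma aux_mcdiarmid {Ω : Type*} [MeasurableSpace Ω] (μ : Measure Ω) [IsProbabilityMeasure μ]
    (M c s : ℝ) (n : ℕ) : ∀ (f : (Fin n → Ω) → ℝ), Measurable f → (∀ x, |f x| ≤ M) → 
    (∀ x i a, f (Function.update x i a) - f x ≤ c) →
    ∫ x, Real.exp (s * f x) ∂(Measure.pi fun _ => μ) ≤
      Real.exp (s * ∫ x, f x ∂(Measure.pi fun _ => μ) + s ^ 2 * (n * c ^ 2) / 8) := by
  induction n with
  | zero =>
    intro f hf hM hd
    simp [integral_unique]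
  | succ n ih =>
    intro f hf hM hd
    set ν : Measure (Fin n → Ω) := Measure.pi fun _ => μ
    have mp := (measurePreserving_piFinSuccAbove (fun _ : Fin (n+1) => μ) 0).symm
    have hcons : Measurable fun p : Ω × (Fin n → Ω) => (Fin.cons p.1 p.2 : Fin (n+1) → Ω) := by
      refine measurable_pi_iff.2 fun i => ?_
      refine Fin.cases ?_ (fun j => ?_) i
      · simpa using measurable_fst
      · simp only [Fin.cons_succ]; fun_prop
    have key : ∀ g : (Fin (n+1) → Ω) → ℝ, Measurable g → ∀ K, (∀ x, |g x| ≤ K) → 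
        ∫ x, g x ∂(Measure.pi fun _ => μ) = ∫ a, ∫ y, g (Fin.cons a y) ∂ν ∂μ := by
      intro g hg K hK
      rw [← mp.integral_comp']
      have : ∀ p : Ω × (Fin n → Ω), (MeasurableEquiv.piFinSuccAbove (fun _ : Fin (n+1) => Ω) 0).symm p
          = (Fin.cons p.1 p.2 : Fin (n+1) → Ω) := by
        intro p
        simp [MeasurableEquiv.piFinSuccAbove_symm_apply, Fin.insertNthEquiv]
      simp_rw [this]
      exact integral_prod _ (Integrable.of_bound (hg.comp hcons).aestronglyMeasurable K
        (ae_of_all _ fun x => hK _))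
    have hexpb : ∀ x, |Real.exp (s * f x)| ≤ Real.exp (|s| * M) := by
      intro x
      rw [abs_of_pos (Real.exp_pos _)]
      refine Real.exp_le_exp.2 ((le_abs_self _).trans ?_)
      rw [abs_mul]; exact mul_le_mul_of_nonneg_left (hM x) (abs_nonneg _)
    rw [key (fun x => Real.exp (s * f x)) (by fun_prop) _ hexpb, key f hf M hM]
    have hfc : Measurable fun p : Ω × (Fin n → Ω) => f (Fin.cons p.1 p.2) := hf.comp hcons
    have hfa : ∀ a, Measurable fun y : Fin n → Ω => f (Fin.cons a y) := fun a =>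
      hfc.comp (measurable_const.prodMk measurable_id)
    set G : Ω → ℝ := fun a => ∫ y, f (Fin.cons a y) ∂ν with hG
    have hGm : Measurable G := hfc.stronglyMeasurable.integral_prod_right'.measurable
    have hGb : ∀ a, |G a| ≤ M := fun a => by
      have := norm_integral_le_of_norm_le_const (μ := ν) (f := fun y => f (Fin.cons a y)) (C := M)
        (ae_of_all _ fun y => hM _)
      simpa using this
    have hint : ∀ a, Integrable (fun y => f (Fin.cons a y)) ν := fun a =>
      Integrable.of_bound (hfa a).aestronglyMeasurable M (ae_of_all _ fun x => hM _)
    have hGd : ∀ a b, G a - G b ≤ c := by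
      intro a b
      rw [hG]
      simp only
      rw [← integral_sub (hint a) (hint b)]
      calc _ ≤ ∫ y, c ∂ν := by
            refine integral_mono ((hint a).sub (hint b)) (integrable_const _) fun y => ?_
            have := hd (Fin.cons b y) 0 a
            simpa using this
        _ = c := by simp
    have h1 := aux_hoeffding μ G hGm M c hGb hGd s
    have h2 : ∀ a, ∫ y, Real.exp (s * f (Fin.cons a y)) ∂ν ≤
        Real.exp (s * G a) * Real.exp (s ^ 2 * (n * c ^ 2) / 8) := by
      intro a
      rw [← Real.exp_add]
      refine ih (fun y => f (Fin.cons a y)) (hfa a) (fun y => hM _) fun x i b => ?_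
      have := hd (Fin.cons a x) i.succ b
      rwa [← Fin.cons_update] at this
    have hGe : Integrable (fun a => Real.exp (s * G a)) μ := by
      refine Integrable.of_bound (by fun_prop) (Real.exp (|s| * M)) (ae_of_all _ fun x => ?_)
      rw [Real.norm_eq_abs, abs_of_pos (Real.exp_pos _)]
      refine Real.exp_le_exp.2 ((le_abs_self _).trans ?_)
      rw [abs_mul]; exact mul_le_mul_of_nonneg_left (hGb x) (abs_nonneg _)
    calc _ ≤ ∫ a, Real.exp (s * G a) * Real.exp (s ^ 2 * (n * c ^ 2) / 8) ∂μ :=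
          integral_mono_of_nonneg (ae_of_all _ fun a => integral_nonneg fun y => (Real.exp_pos _).le)
            (hGe.mul_const _) (ae_of_all _ h2)
      _ = (∫ a, Real.exp (s * G a) ∂μ) * Real.exp (s ^ 2 * (n * c ^ 2) / 8) := integral_mul_const _ _
      _ ≤ Real.exp (s * ∫ x, G x ∂μ + s ^ 2 * c ^ 2 / 8) * Real.exp (s ^ 2 * (n * c ^ 2) / 8) :=
          mul_le_mul_of_nonneg_right h1 (Real.exp_pos _).le
      _ = _ := by
          rw [← Real.exp_add]; congr 1; push_cast; ring

/-- mean over coordinates -/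
lemma aux_mean {Ω : Type*} [MeasurableSpace Ω] (μ : Measure Ω) [IsProbabilityMeasure μ]
    (n : ℕ) (hn : 1 ≤ n) (g : Ω → ℝ) (hg : Measurable g) (M : ℝ) (hM : ∀ x, |g x| ≤ M) :
    ∫ x : Fin n → Ω, (1 / (n : ℝ)) * ∑ i, g (x i) ∂(Measure.pi fun _ => μ) = ∫ x, g x ∂μ := by
  have hn' : (n : ℝ) ≠ 0 := by positivity
  rw [integral_const_mul, integral_finsetSum]
  · have : ∀ i : Fin n, ∫ x : Fin n → Ω, g (x i) ∂(Measure.pi fun _ => μ) = ∫ x, g x ∂μ := fun i =>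
      integral_comp_eval (μ := fun _ : Fin n => μ) hg.aestronglyMeasurable
    simp [this]; field_simp
  · intro i _
    exact Integrable.of_bound (Measurable.aestronglyMeasurable (by fun_prop)) M (ae_of_all _ fun x => hM _)

lemma aux_update_sum {Ω : Type*} (n : ℕ) (g : Ω → ℝ) (x : Fin n → Ω) (i : Fin n) (a : Ω) :
    ∑ j, g (Function.update x i a j) = ∑ j, g (x j) + (g a - g (x i)) := by
  have h : (fun j => g (Function.update x i a j)) = Function.update (fun j => g (x j)) i (g a) := by
    ext j; by_cases h : j = i
    · subst h; simp
    · simp [h]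
  have := Finset.sum_update_of_mem (Finset.mem_univ i) (fun j => g (x j)) (g a)
  rw [h, this, ← Finset.sum_sdiff (Finset.subset_univ {i}) (f := fun j => g (x j))]
  simp; ring

/-- MGF bound for the empirical cost -/
lemma aux_emp {W : Type*} [MeasurableSpace W] (D : Measure W) [IsProbabilityMeasure D] (C : ℝ)
    (l : W → ℝ) (hl : Measurable l) (hb : ∀ w, l w ∈ Set.Icc 0 C) (S : ℕ) (hS : 1 ≤ S) (lam : ℝ) :
    ∫ x : Fin S → W, Real.exp (-lam * ((1 / (S : ℝ)) * ∑ s, l (x s))) ∂(Measure.pi fun _ => D) ≤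
      Real.exp (- lam * ∫ w, l w ∂D + lam ^ 2 * C ^ 2 / (8 * S)) := by
  have hS' : (0 : ℝ) < S := by positivity
  have hb' : ∀ w, |l w| ≤ C := fun w => by rw [abs_of_nonneg (hb w).1]; exact (hb w).2
  have := aux_mcdiarmid D C (C / S) (-lam) S (fun x => (1 / (S : ℝ)) * ∑ s, l (x s)) (by fun_prop)
    (fun x => by
      rw [abs_mul, abs_of_pos (by positivity)]
      have : |∑ s, l (x s)| ≤ ∑ s : Fin S, C :=
        (Finset.abs_sum_le_sum_abs _ _).trans (Finset.sum_le_sum fun i _ => hb' _)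
      simp at this
      rw [one_div, inv_mul_le_iff₀ hS']; exact this)
    (fun x i a => by
      rw [aux_update_sum, ← mul_sub, add_sub_cancel_left, one_div, inv_mul_le_iff₀ hS']
      have : (S : ℝ) * (C / S) = C := by field_simp
      rw [this]; linarith [(hb a).2, (hb (x i)).1])
  rw [aux_mean D S hS l hl C hb'] at this
  convert this using 3
  field_simp

/-- Concentration of the Monte Carlo estimate -/
lemma aux_mc {Θ : Type*} [MeasurableSpace Θ] (P : Measure Θ) [IsProbabilityMeasure P] (B : ℝ)
    (hB : 0 < B)
    (g : Θ → ℝ) (hg : Measurable g) (hb : ∀ w, g w ∈ Set.Icc (Real.exp (-B)) 1)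
    (N : ℕ) (hN : 1 ≤ N) (δ : ℝ) (hδ : δ ∈ Set.Ioo (0 : ℝ) 1) :
    (Measure.pi fun _ : Fin N => P) {x | Real.log (∫ θ, g θ ∂P) +
      Real.log (1 + (Real.exp B - 1) / N) * Real.sqrt (((N : ℝ) / 2) * Real.log (1 / δ)) ≤
        Real.log ((1 / (N : ℝ)) * ∑ n, g (x n))} ≤ ENNReal.ofReal δ := by
  have hN' : (0 : ℝ) < N := by positivity
  set ν := Measure.pi fun _ : Fin N => P
  set Zh : (Fin N → Θ) → ℝ := fun x => (1 / (N : ℝ)) * ∑ n, g (x n) with hZh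
  set c := Real.log (1 + (Real.exp B - 1) / N) with hc
  have hE : 0 < Real.exp B - 1 := by linarith [Real.add_one_lt_exp hB.ne']
  have hcpos : 0 < c := Real.log_pos (by have := div_pos hE hN'; linarith)
  have hgpos : ∀ w, 0 < g w := fun w => (Real.exp_pos _).trans_le (hb w).1
  have hgb : ∀ w, |g w| ≤ 1 := fun w => by rw [abs_of_pos (hgpos w)]; exact (hb w).2
  have hZm : Measurable Zh := by fun_prop
  have hZl : ∀ x, Real.exp (-B) ≤ Zh x := fun x => by
    have : ∑ s : Fin N, Real.exp (-B) ≤ ∑ s, g (x s) := Finset.sum_le_sum fun i _ => (hb _).1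
    simp at this
    simp only [hZh]; rw [one_div, le_inv_mul_iff₀ hN']; exact this
  have hZu : ∀ x, Zh x ≤ 1 := fun x => by
    have : ∑ s, g (x s) ≤ ∑ s : Fin N, (1:ℝ) := Finset.sum_le_sum fun i _ => (hb _).2
    simp at this
    simp only [hZh]; rw [one_div, inv_mul_le_iff₀ hN']; linarith
  have hZp : ∀ x, 0 < Zh x := fun x => (Real.exp_pos _).trans_le (hZl x)
  have hlogb : ∀ x, |Real.log (Zh x)| ≤ B := fun x => by
    rw [abs_le]; constructor
    · rw [Real.le_log_iff_exp_le (hZp x)]; exact hZl x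
    · exact (Real.log_nonpos (hZp x).le (hZu x)).trans hB.le
  have hdiff : ∀ x i a, Real.log (Zh (Function.update x i a)) - Real.log (Zh x) ≤ c := by
    intro x i a
    rw [← Real.log_div (hZp _).ne' (hZp _).ne']
    refine Real.log_le_log (div_pos (hZp _) (hZp _)) ?_
    rw [div_le_iff₀ (hZp _)]
    have h1 : Zh (Function.update x i a) = Zh x + (1 / (N : ℝ)) * (g a - g (x i)) := by
      simp only [hZh]; rw [aux_update_sum, mul_add]
    have h2 : g a - g (x i) ≤ (Real.exp B - 1) * Zh x := by
      have : (Real.exp B - 1) * Real.exp (-B) ≤ (Real.exp B - 1) * Zh x :=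
        mul_le_mul_of_nonneg_left (hZl x) hE.le
      have h3 : Real.exp B * Real.exp (-B) = 1 := by rw [← Real.exp_add]; simp
      have := (hb a).2; have := (hb (x i)).1
      nlinarith
    have h4 := mul_le_mul_of_nonneg_left h2 (show 0 ≤ 1 / (N : ℝ) by positivity)
    rw [h1]
    calc _ ≤ Zh x + 1 / (N : ℝ) * ((Real.exp B - 1) * Zh x) := by linarith
      _ = _ := by ring
  set Z := ∫ θ, g θ ∂P with hZ
  have hmean : ∫ x, Zh x ∂ν = Z := aux_mean P N hN g hg 1 hgb
  have hZint : Integrable Zh ν := Integrable.of_bound hZm.aestronglyMeasurable 1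
    (ae_of_all _ fun x => by rw [Real.norm_eq_abs, abs_of_pos (hZp x)]; exact hZu x)
  have hlint : Integrable (fun x => Real.log (Zh x)) ν := Integrable.of_bound
    (Measurable.aestronglyMeasurable (by fun_prop)) B (ae_of_all _ fun x => hlogb x)
  have hZpos : 0 < Z := by
    have : ∫ x, Real.exp (-B) ∂ν ≤ ∫ x, Zh x ∂ν := integral_mono (integrable_const _) hZint hZl
    rw [hmean] at this; simp at this
    exact (Real.exp_pos _).trans_le this
  have hjensen : ∫ x, Real.log (Zh x) ∂ν ≤ Real.log Z := by
    calc _ ≤ ∫ x, ((Real.log Z - 1) + Zh x / Z) ∂ν := by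
          refine integral_mono hlint ((integrable_const _).add (hZint.div_const _)) fun x => ?_
          have := Real.log_le_sub_one_of_pos (div_pos (hZp x) hZpos)
          rw [Real.log_div (hZp x).ne' hZpos.ne'] at this
          simp only; linarith
      _ = _ := by
          rw [integral_add (integrable_const _) (hZint.div_const _), integral_div, hmean,
            div_self hZpos.ne']; simp
  set r := Real.sqrt (((N : ℝ) / 2) * Real.log (1 / δ)) with hr
  have hlogδ : 0 < Real.log (1 / δ) := Real.log_pos (by rw [lt_div_iff₀ hδ.1]; linarith [hδ.2])
  have hr2 : r ^ 2 = ((N : ℝ) / 2) * Real.log (1 / δ) := Real.sq_sqrt (by positivity)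
  have hrpos : 0 < r := Real.sqrt_pos.2 (by positivity)
  set s := 4 * r / (N * c) with hs
  have hspos : 0 < s := by positivity
  have hmgf := aux_mcdiarmid P B c s N (fun x => Real.log (Zh x)) (by fun_prop) hlogb hdiff
  have hmark := meas_ge_le_lintegral_div (μ := ν)
    (f := fun x => ENNReal.ofReal (Real.exp (s * Real.log (Zh x))))
    (by fun_prop) (ε := ENNReal.ofReal (Real.exp (s * (Real.log Z + c * r))))
    (by simp [Real.exp_pos]) (by simp)
  refine (measure_mono ?_).trans (hmark.trans ?_)
  · intro x hx
    simp only [Set.mem_ofPred_eq] at hx ⊢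
    exact ENNReal.ofReal_le_ofReal (Real.exp_le_exp.2 (mul_le_mul_of_nonneg_left hx hspos.le))
  · rw [← ofReal_integral_eq_lintegral_ofReal, ← ENNReal.ofReal_div_of_pos (Real.exp_pos _)]
    · refine ENNReal.ofReal_le_ofReal ?_
      rw [div_le_iff₀ (Real.exp_pos _)]
      refine hmgf.trans ?_
      have hδe : δ = Real.exp (- Real.log (1 / δ)) := by
        rw [one_div, Real.log_inv, neg_neg, Real.exp_log hδ.1]
      rw [hδe, ← Real.exp_add]
      refine Real.exp_le_exp.2 ?_
      have h5 := mul_le_mul_of_nonneg_left hjensen hspos.le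
      have h6 : s ^ 2 * (N * c ^ 2) / 8 = Real.log (1 / δ) := by
        have : s ^ 2 * (N * c ^ 2) / 8 = 2 * r ^ 2 / N := by rw [hs]; field_simp; ring
        rw [this, hr2]; field_simp
      have h7 : s * (c * r) = 2 * Real.log (1 / δ) := by
        have : s * (c * r) = 4 * r ^ 2 / N := by rw [hs]; field_simp
        rw [this, hr2]; field_simp; ring
      rw [h6, mul_add, h7]; linarith
    · refine Integrable.of_bound (Measurable.aestronglyMeasurable (by fun_prop)) (Real.exp (s * B)) (ae_of_all _ fun x => ?_)
      rw [Real.norm_eq_abs, abs_of_pos (Real.exp_pos _)]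
      exact Real.exp_le_exp.2 (mul_le_mul_of_nonneg_left ((le_abs_self _).trans (hlogb x)) hspos.le)
    · exact ae_of_all _ fun x => (Real.exp_pos _).le

/-- Tractable PAC-Bayes upper bound for the optimal Gibbs posterior, with the
partition function replaced by its Monte Carlo estimate. -/
theorem pac_bayes_upper_bound_monte_carlo
    {Θ W : Type*} [MeasurableSpace Θ] [MeasurableSpace W]
    (D : Measure W) [IsProbabilityMeasure D]
    (C : ℝ) (hC : 0 < C)
    (L : Θ × W → ℝ) (hL : Measurable L) (hLb : ∀ θ w, L (θ, w) ∈ Set.Icc 0 C)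
    (S NP : ℕ) (hS : 1 ≤ S) (hNP : 1 ≤ NP)
    (P : Measure Θ) [IsProbabilityMeasure P]
    (lam : ℝ) (hlam : 0 < lam)
    (Qstar : Kernel (Fin S → W) Θ) [IsMarkovKernel Qstar]
    (hQ : ∀ data : Fin S → W,
      Qstar data = P.withDensity fun θ => ENNReal.ofReal
        (Real.exp (-lam * ((1 / (S : ℝ)) * ∑ s : Fin S, L (θ, data s))) /
          ∫ θ', Real.exp (-lam * ((1 / (S : ℝ)) * ∑ s : Fin S, L (θ', data s))) ∂P))
    (δ : ℝ) (hδ : δ ∈ Set.Ioo (0 : ℝ) 1) :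
    ENNReal.ofReal (1 - 2 * δ) ≤
      ((((Measure.pi fun _ : Fin S => D) ⊗ₘ Qstar)).prod
          (Measure.pi fun _ : Fin NP => P))
        {p : ((Fin S → W) × Θ) × (Fin NP → Θ) |
          (∫ w, L (p.1.2, w) ∂D) ≤
            -(1 / lam) * Real.log
              ((1 / (NP : ℝ)) * ∑ n : Fin NP,
                Real.exp (-lam * ((1 / (S : ℝ)) * ∑ s : Fin S, L (p.2 n, p.1.1 s))))
            + (1 / lam) * Real.log (1 / δ)
            + lam * C ^ 2 / (8 * S)
            + (1 / lam) * Real.log (1 + (Real.exp (lam * C) - 1) / NP) *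
                Real.sqrt (((NP : ℝ) / 2) * Real.log (1 / δ))} := by
  have hS' : (0 : ℝ) < S := by positivity
  have hN' : (0 : ℝ) < NP := by positivity
  set μ : Measure (Fin S → W) := Measure.pi fun _ => D with hμ
  set ν : Measure (Fin NP → Θ) := Measure.pi fun _ => P with hν
  set E : (Fin S → W) → Θ → ℝ := fun data θ =>
    Real.exp (-lam * ((1 / (S : ℝ)) * ∑ s : Fin S, L (θ, data s))) with hE
  set Z : (Fin S → W) → ℝ := fun data => ∫ θ, E data θ ∂P with hZ
  set T : Θ → ℝ := fun θ => ∫ w, L (θ, w) ∂D with hT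
  set k : ℝ := lam ^ 2 * C ^ 2 / (8 * S) with hk
  have hEm : Measurable fun p : (Fin S → W) × Θ => E p.1 p.2 := by
    simp only [hE]; fun_prop
  have hEm1 : ∀ data, Measurable (E data) := fun data => 
    hEm.comp (measurable_const.prodMk measurable_id)
  have hTm : Measurable T := hL.stronglyMeasurable.integral_prod_right'.measurable
  have hZm : Measurable Z := hEm.stronglyMeasurable.integral_prod_right'.measurable
  have hEb : ∀ data θ, E data θ ∈ Set.Icc (Real.exp (-(lam * C))) 1 := by
    intro data θ
    have h0 : 0 ≤ (1 / (S : ℝ)) * ∑ s : Fin S, L (θ, data s) :=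
      mul_nonneg (by positivity) (Finset.sum_nonneg fun i _ => (hLb _ _).1)
    have h1 : (1 / (S : ℝ)) * ∑ s : Fin S, L (θ, data s) ≤ C := by
      have : ∑ s : Fin S, L (θ, data s) ≤ ∑ s : Fin S, C := Finset.sum_le_sum fun i _ => (hLb _ _).2
      simp at this
      rw [one_div, inv_mul_le_iff₀ hS']; exact this
    have h2 := mul_le_mul_of_nonneg_left h1 hlam.le
    have h3 := mul_nonneg hlam.le h0
    constructor
    · exact Real.exp_le_exp.2 (by linarith)
    · exact Real.exp_le_one_iff.2 (by linarith)
  have hEpos : ∀ data θ, 0 < E data θ := fun data θ => Real.exp_pos _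
  have hZpos : ∀ data, 0 < Z data := by
    intro data
    have : ∫ x, Real.exp (-(lam * C)) ∂P ≤ ∫ θ, E data θ ∂P := integral_mono (integrable_const _)
      (Integrable.of_bound (hEm1 data).aestronglyMeasurable 1 (ae_of_all _ fun θ => by
        rw [Real.norm_eq_abs, abs_of_pos (hEpos _ _)]; exact (hEb _ _).2)) fun θ => (hEb _ _).1
    simp at this
    exact (Real.exp_pos _).trans_le this
  -- event A
  set A : Set ((Fin S → W) × Θ) :=
    {p | Real.log (1 / δ) ≤ lam * T p.2 + Real.log (Z p.1) - k} with hA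
  have hAm : (μ ⊗ₘ Qstar) A ≤ ENNReal.ofReal δ := by
    have hfm : Measurable fun p : (Fin S → W) × Θ =>
      ENNReal.ofReal (Z p.1 * Real.exp (lam * T p.2 - k)) := by fun_prop
    have hmark := meas_ge_le_lintegral_div (μ := μ ⊗ₘ Qstar) hfm.aemeasurable
      (ε := ENNReal.ofReal (1 / δ)) (by simp [hδ.1]) (by simp)
    refine (measure_mono ?_).trans (hmark.trans ?_)
    · intro p hp
      simp only [hA, Set.mem_ofPred_eq] at hp ⊢
      refine ENNReal.ofReal_le_ofReal ?_
      rw [← Real.exp_log (hZpos p.1), ← Real.exp_add, 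
        ← Real.log_le_iff_le_exp (one_div_pos.2 hδ.1)]
      linarith
    · have hint : ∫⁻ p, ENNReal.ofReal (Z p.1 * Real.exp (lam * T p.2 - k)) ∂(μ ⊗ₘ Qstar) ≤ 1 := by
        rw [Measure.lintegral_compProd hfm]
        have h1 : ∀ data, ∫⁻ θ, ENNReal.ofReal (Z data * Real.exp (lam * T θ - k)) ∂(Qstar data)
            = ∫⁻ θ, ENNReal.ofReal (E data θ * Real.exp (lam * T θ - k)) ∂P := by
          intro data
          rw [hQ data, lintegral_withDensity_eq_lintegral_mul _ 
            (by have := hEm1 data; fun_prop) (by fun_prop)]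
          refine lintegral_congr fun θ => ?_
          simp only [Pi.mul_apply]
          rw [← ENNReal.ofReal_mul (div_nonneg (hEpos _ _).le (hZpos data).le)]
          congr 1
          have := (hZpos data).ne'
          field_simp
        simp_rw [h1]
        rw [lintegral_lintegral_swap (by 
          apply Measurable.aemeasurable
          change Measurable fun p : (Fin S → W) × Θ => 
            ENNReal.ofReal (E p.1 p.2 * Real.exp (lam * T p.2 - k))
          fun_prop)]
        calc _ ≤ ∫⁻ θ, 1 ∂P := by
              refine lintegral_mono fun θ => ?_
              have hEm2 : Measurable fun data => E data θ := 
                hEm.comp (measurable_id.prodMk measurable_const)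
              rw [← ofReal_integral_eq_lintegral_ofReal]
              · rw [← ENNReal.ofReal_one]
                refine ENNReal.ofReal_le_ofReal ?_
                rw [integral_mul_const]
                have := aux_emp D C (fun w => L (θ, w)) (by fun_prop) (hLb θ) S hS lam
                calc _ ≤ Real.exp (-lam * T θ + k) * Real.exp (lam * T θ - k) :=
                      mul_le_mul_of_nonneg_right this (Real.exp_pos _).le
                  _ = 1 := by rw [← Real.exp_add]; simp
              · refine Integrable.mul_const (Integrable.of_bound hEm2.aestronglyMeasurable 1 
                  (ae_of_all _ fun data => ?_)) _
                rw [Real.norm_eq_abs, abs_of_pos (hEpos _ _)]; exact (hEb _ _).2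
              · exact ae_of_all _ fun data => mul_nonneg (hEpos _ _).le (Real.exp_pos _).le
          _ = 1 := by simp
      calc _ ≤ 1 / ENNReal.ofReal (1 / δ) := ENNReal.div_le_div_right hint _
        _ = ENNReal.ofReal δ := by
          rw [← ENNReal.ofReal_one, ← ENNReal.ofReal_div_of_pos (one_div_pos.2 hδ.1)]
          simp
  -- event B
  set t : ℝ := Real.log (1 + (Real.exp (lam * C) - 1) / NP) *
                Real.sqrt (((NP : ℝ) / 2) * Real.log (1 / δ)) with ht
  set B : Set (((Fin S → W) × Θ) × (Fin NP → Θ)) :=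
    {p | Real.log (Z p.1.1) + t ≤ Real.log ((1 / (NP : ℝ)) * ∑ n, E p.1.1 (p.2 n))} with hB
  have hBms : MeasurableSet B := by
    refine measurableSet_le (by fun_prop) ?_
    refine Real.measurable_log.comp (measurable_const.mul (Finset.measurable_sum _ fun n _ => ?_))
    exact hEm.comp (f := fun p : ((Fin S → W) × Θ) × (Fin NP → Θ) => (p.1.1, p.2 n)) (by fun_prop)
  have hBm : ((μ ⊗ₘ Qstar).prod ν) B ≤ ENNReal.ofReal δ := by
    rw [Measure.prod_apply hBms]
    calc _ ≤ ∫⁻ p, ENNReal.ofReal δ ∂(μ ⊗ₘ Qstar) := lintegral_mono fun p =>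
          aux_mc P (lam * C) (by positivity) (E p.1) (hEm1 _) (hEb _) NP hNP δ hδ
      _ = _ := by simp
  have hAm' : ((μ ⊗ₘ Qstar).prod ν) (A ×ˢ Set.univ) ≤ ENNReal.ofReal δ := by
    rw [Measure.prod_prod]; simpa using hAm
  set G : Set (((Fin S → W) × Θ) × (Fin NP → Θ)) := {p | _} with hG
  have hcov : (Set.univ : Set (((Fin S → W) × Θ) × (Fin NP → Θ))) ⊆ G ∪ (A ×ˢ Set.univ ∪ B) := by
    intro p _
    by_contra hcon
    simp only [Set.mem_union, not_or] at hcon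
    obtain ⟨hg, ha, hb⟩ := hcon
    apply hg
    have ha' : lam * T p.1.2 + Real.log (Z p.1.1) - k < Real.log (1 / δ) := by
      by_contra h; exact ha ⟨not_lt.1 h, trivial⟩
    have hb' : Real.log ((1 / (NP : ℝ)) * ∑ n, E p.1.1 (p.2 n)) < Real.log (Z p.1.1) + t := 
      not_le.1 hb
    set lz := Real.log ((1 / (NP : ℝ)) * ∑ n, E p.1.1 (p.2 n)) with hlz
    have hfin : lam * T p.1.2 ≤ -lz + Real.log (1 / δ) + k + t := by linarith
    change T p.1.2 ≤ -(1 / lam) * lz + (1 / lam) * Real.log (1 / δ) + lam * C ^ 2 / (8 * S) +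
      (1 / lam) * Real.log (1 + (Real.exp (lam * C) - 1) / NP) *
                Real.sqrt (((NP : ℝ) / 2) * Real.log (1 / δ))
    have e : -(1 / lam) * lz + (1 / lam) * Real.log (1 / δ) + lam * C ^ 2 / (8 * S) +
      (1 / lam) * Real.log (1 + (Real.exp (lam * C) - 1) / NP) *
                Real.sqrt (((NP : ℝ) / 2) * Real.log (1 / δ))
        = (-lz + Real.log (1 / δ) + k + t) / lam := by
      rw [mul_assoc (1 / lam), ← ht, hk]; field_simp
    rw [e, le_div_iff₀ hlam]; linarith
  have hle : (1 : ENNReal) ≤ ((μ ⊗ₘ Qstar).prod ν) G + ENNReal.ofReal (2 * δ) := by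
    calc (1 : ENNReal) = ((μ ⊗ₘ Qstar).prod ν) Set.univ := by simp
      _ ≤ _ := measure_mono hcov
      _ ≤ _ := measure_union_le _ _
      _ ≤ _ := by
        gcongr
        refine (measure_union_le _ _).trans ((add_le_add hAm' hBm).trans ?_)
        rw [← ENNReal.ofReal_add hδ.1.le hδ.1.le, two_mul]
  rw [ENNReal.ofReal_sub _ (by linarith [hδ.1]), ENNReal.ofReal_one]
  exact tsub_le_iff_right.2 hle
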